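/- Fix $N \ge 2$, indices $i \ne j$, and module dimensions satisfying $w_i > 0$, $w_j > 0$, $h_i > 0$, $h_j > 0$, $w_i + w_j \le W$, $h_i \le H$, and $h_j \le H$. Then the combined constraint set $C_{i,j} := (O_{i,j}^x \cup O_{j,i}^x \cup O_{i,j}^y \cup O_{j,i}^y) \cap B_i^x \cap B_i^y \cap B_j^x \cap B_j^y \subseteq \mathbb{R}^{2N}$ is NOT convex: there exist points $z_1, z_2 \in C_{i,j}$ (with module $i$ left of module $j$ in $z_1$ and right of module $j$ in $z_2$) whose midpoint $\tfrac{1}{2}(z_1 + z_2)$ does not belong to $C_{i,j}$. -/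

import Mathlib

/-- `B_i^x = {z : 0 ≤ x_i ≤ W - w_i}`; a configuration of `N` placed objects is encoded as
`z ∈ ℝ^{2N} = EuclideanSpace ℝ (Fin N ⊕ Fin N)` with `z (Sum.inl i) = x_i`, `z (Sum.inr i) = y_i`. -/
def Bx (N : ℕ) (i : Fin N) (W wi : ℝ) : Set (EuclideanSpace ℝ (Fin N ⊕ Fin N)) :=
  {z | 0 ≤ z (Sum.inl i) ∧ z (Sum.inl i) ≤ W - wi}

/-- `B_i^y = {z : 0 ≤ y_i ≤ H - h_i}`. -/
def By (N : ℕ) (i : Fin N) (H hi : ℝ) : Set (EuclideanSpace ℝ (Fin N ⊕ Fin N)) :=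
  {z | 0 ≤ z (Sum.inr i) ∧ z (Sum.inr i) ≤ H - hi}

/-- `O_{i,j}^x = {z : x_i + w_i ≤ x_j}` (module `i` is to the left of module `j`). -/
def Ox (N : ℕ) (i j : Fin N) (wi : ℝ) : Set (EuclideanSpace ℝ (Fin N ⊕ Fin N)) :=
  {z | z (Sum.inl i) + wi ≤ z (Sum.inl j)}

/-- `O_{i,j}^y = {z : y_i + h_i ≤ y_j}` (module `i` is below module `j`). -/
def Oy (N : ℕ) (i j : Fin N) (hi : ℝ) : Set (EuclideanSpace ℝ (Fin N ⊕ Fin N)) :=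
  {z | z (Sum.inr i) + hi ≤ z (Sum.inr j)}

/-- The combined boundary-and-non-overlap constraint set
`C_{i,j} = (O_{i,j}^x ∪ O_{j,i}^x ∪ O_{i,j}^y ∪ O_{j,i}^y) ∩ B_i^x ∩ B_i^y ∩ B_j^x ∩ B_j^y`. -/
def Cij (N : ℕ) (i j : Fin N) (wi wj hi hj W H : ℝ) :
    Set (EuclideanSpace ℝ (Fin N ⊕ Fin N)) :=
  (Ox N i j wi ∪ Ox N j i wj ∪ Oy N i j hi ∪ Oy N j i hj) ∩
    Bx N i W wi ∩ By N i H hi ∩ Bx N j W wj ∩ By N j H hj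

/-- Under positive module dimensions fitting in the region, the combined constraint set
`C_{i,j}` is not convex: there are `z₁, z₂ ∈ C_{i,j}` (module `i` left of `j` in `z₁`,
right of `j` in `z₂`) whose midpoint is not in `C_{i,j}`. -/
theorem combined_constraint_not_convex (N : ℕ) (hN : 2 ≤ N) (i j : Fin N) (hij : i ≠ j)
    (wi wj hi hj W H : ℝ) (hwi : 0 < wi) (hwj : 0 < wj) (hhi : 0 < hi) (hhj : 0 < hj)
    (hW : wi + wj ≤ W) (hHi : hi ≤ H) (hHj : hj ≤ H) :
    ∃ z₁ z₂ : EuclideanSpace ℝ (Fin N ⊕ Fin N),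
      z₁ ∈ Cij N i j wi wj hi hj W H ∧ z₂ ∈ Cij N i j wi wj hi hj W H ∧
      z₁ ∈ Ox N i j wi ∧ z₂ ∈ Ox N j i wj ∧
      (2:ℝ)⁻¹ • (z₁ + z₂) ∉ Cij N i j wi wj hi hj W H := by
  have hne : (Sum.inl i : Fin N ⊕ Fin N) ≠ Sum.inl j := fun h => hij (Sum.inl.inj h)
  refine ⟨EuclideanSpace.single (Sum.inl j) wi, EuclideanSpace.single (Sum.inl i) wj, ?_⟩
  simp only [Cij, Ox, Oy, Bx, By, Set.mem_inter_iff, Set.mem_union, Set.mem_ofPred_eq,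
    PiLp.add_apply, PiLp.smul_apply, smul_eq_mul, PiLp.single_apply, hne, hne.symm,
    reduceCtorEq, if_true, if_false]
  refine ⟨⟨⟨⟨⟨Or.inl (Or.inl (Or.inl ?_)), ?_, ?_⟩, ?_, ?_⟩, ?_, ?_⟩, ?_, ?_⟩,
    ⟨⟨⟨⟨Or.inl (Or.inl (Or.inr ?_)), ?_, ?_⟩, ?_, ?_⟩, ?_, ?_⟩, ?_, ?_⟩, ?_, ?_, ?_⟩
  case refine_21 =>
    rintro ⟨⟨⟨⟨((h | h) | h) | h, -⟩, -⟩, -⟩, -⟩ <;> linarith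
  all_goals linarith
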